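/- Let f : ℝⁿ → ℝ be real analytic near 0 with f(0) = 0, and suppose there exist C > 0, K > 0, and ρ ∈ (0,1) such that ‖∇f(x)‖ ≥ K·|f(x)|^ρ for all x in a neighborhood of 0 (a Łojasiewicz gradient inequality). Then for c > 0 small enough and k a large enough integer, 0 is a regular value of the restriction of g(x) = f(x) − c‖x‖^{2k} to every sphere S_r = {x : ‖x‖ = r} with r > 0 sufficiently small; that is, at every point x ∈ S_r with g(x) = 0, the gradient ∇g(x) is not parallel to x. -/

import Mathlib

open scoped Topology

theorem eq_of_le_of_height_le_one {B : Type*} [CommRing B] [IsDomain B] {p q : Ideal B}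
    [p.IsPrime] [q.IsPrime] (hp : p.height ≤ 1) (hq : q ≠ ⊥) (hqp : q ≤ p) : q = p := by
  by_contra hne
  have h1 := (Ideal.height_add_one_le_of_lt_of_isPrime (lt_of_le_of_ne hqp hne)).trans hp
  refine hq (Ideal.height_eq_zero_iff_eq_bot.1 (nonpos_iff_eq_zero.1 ?_))
  exact (ENat.add_le_add_iff_right ENat.one_ne_top).1 (by simpa using h1)

theorem eq_maximalIdeal_of_forall_prime_mem {B : Type*} [CommRing B] [IsNoetherianRing B]
    [IsLocalRing B] [IsDomain B] {h : B}
    (hh : h ∈ IsLocalRing.maximalIdeal B)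
    (hprime : ∀ q : Ideal B, q.IsPrime → q ≠ ⊥ → h ∈ q) (h0 : h ≠ 0) (q : Ideal B) [q.IsPrime]
    (hq : q ≠ ⊥) :
    q = IsLocalRing.maximalIdeal B := by
  have hfin : (Ideal.span {h}).minimalPrimes.Finite :=
    Ideal.finite_minimalPrimes_of_isNoetherianRing B _
  have hcover : ((IsLocalRing.maximalIdeal B : Ideal B) : Set B) ⊆
      ⋃ i ∈ ((hfin.toFinset.filter fun p => p.height ≤ 1 : Finset (Ideal B)) : Set (Ideal B)),
          (i : Set B) := by
    intro x hx
    simp only [Finset.coe_filter, Set.Finite.mem_toFinset, Set.mem_ofPred_eq, Set.mem_iUnion]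
    by_cases hx0 : x = 0
    · obtain ⟨p, hp, -⟩ := Ideal.exists_minimalPrimes_le
        ((Ideal.span_singleton_le_iff_mem _).2 hh)
      exact ⟨p, ⟨hp, Ideal.height_le_one_of_isPrincipal_of_mem_minimalPrimes _ _ hp⟩,
        by simp [hx0]⟩
    · obtain ⟨p, hp, -⟩ := Ideal.exists_minimalPrimes_le
        ((Ideal.span_singleton_le_iff_mem _).2 hx)
      have hpp := hp.1.1
      have hxp : x ∈ p := (Ideal.span_singleton_le_iff_mem _).1 hp.1.2
      have hp1 := Ideal.height_le_one_of_isPrincipal_of_mem_minimalPrimes _ _ hp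
      have hhp : h ∈ p := hprime p hpp (by rintro rfl; exact hx0 (by simpa using hxp))
      refine ⟨p, ⟨⟨⟨hpp, (Ideal.span_singleton_le_iff_mem _).2 hhp⟩, ?_⟩, hp1⟩, hxp⟩
      rintro r ⟨hr, hhr⟩ hrp
      have hr0 : r ≠ ⊥ := by rintro rfl; exact h0 (by simpa using hhr)
      exact (eq_of_le_of_height_le_one hp1 hr0 hrp).ge
  obtain ⟨p, hp, hmp⟩ := (Ideal.subset_union_prime ⊥ ⊥ fun i hi _ _ => by
    simp only [Finset.mem_filter, Set.Finite.mem_toFinset] at hi; exact hi.1.1.1).1 hcover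
  simp only [Finset.mem_filter, Set.Finite.mem_toFinset] at hp
  have hpp := hp.1.1.1
  have hpm : p = IsLocalRing.maximalIdeal B :=
    le_antisymm (IsLocalRing.le_maximalIdeal hpp.ne_top) hmp
  rw [← hpm]
  exact eq_of_le_of_height_le_one hp.2 hq (hpm ▸ IsLocalRing.le_maximalIdeal ‹q.IsPrime›.ne_top)

theorem exists_maximalIdeal_pow_le_span {B : Type*} [CommRing B] [IsNoetherianRing B]
    [IsLocalRing B] (hB : ∀ q : Ideal B, q.IsPrime → q ≠ ⊥ → q = IsLocalRing.maximalIdeal B)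
    {t : B} (ht : t ≠ 0) : ∃ N : ℕ, IsLocalRing.maximalIdeal B ^ N ≤ Ideal.span {t} := by
  refine Ideal.exists_pow_le_of_le_radical_of_fg ?_ (IsNoetherian.noetherian _)
  rw [Ideal.radical_eq_sInf]
  refine le_sInf fun q ⟨hq, hqp⟩ => (hB q hqp ?_).ge
  rintro rfl
  exact ht (by simpa using hq)

theorem isPrecomplete_pi {A ι : Type*} [CommRing A] [Finite ι] (I : Ideal A) [IsPrecomplete I A] :
    IsPrecomplete I (ι → A) := by
  have := Fintype.ofFinite ι
  classical
  have key : ∀ (n : ℕ) (x y : ι → A), x ≡ y [SMOD (I ^ n • ⊤ : Submodule A (ι → A))] ↔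
      ∀ i, x i ≡ y i [SMOD (I ^ n • ⊤ : Submodule A A)] := by
    intro n x y
    simp only [SModEq.sub_mem, smul_eq_mul, Ideal.mul_top]
    constructor
    · intro h i
      have := Submodule.mem_map_of_mem (f := LinearMap.proj (R := A) (φ := fun _ : ι => A) i) h
      rw [Submodule.map_smul''] at this
      simpa using (Submodule.smul_mono le_rfl le_top) this
    · intro h
      rw [pi_eq_sum_univ (x - y)]
      exact Submodule.sum_mem _ fun i _ => Submodule.smul_mem_smul (h i) trivial
  refine ⟨fun f hf => ?_⟩
  choose L hL using fun i => IsPrecomplete.prec ‹IsPrecomplete I A› (f := fun n => f n i)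
    fun {m n} hmn => (key m _ _).1 (hf hmn) i
  exact ⟨L, fun n => (key n _ _).2 fun i => hL i n⟩

theorem exists_finite_span_sup_pow {K B : Type*} [Field K] [CommRing B] [IsNoetherianRing B]
    [Algebra K B] (m : Ideal B) (hres : ∀ b : B, ∃ k : K, b - algebraMap K B k ∈ m) (n : ℕ) :
    ∃ s : Finset B, ∀ b : B, ∃ c ∈ Submodule.span K (s : Set B), b - c ∈ m ^ n := by
  classical
  induction n with
  | zero => exact ⟨∅, fun b => ⟨0, by simp, by simp⟩⟩
  | succ n ih =>
    obtain ⟨s, hs⟩ := ih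
    obtain ⟨g, hg⟩ := (IsNoetherian.noetherian m : m.FG)
    refine ⟨insert 1 (Finset.image₂ (· * ·) g s), fun b => ?_⟩
    have hm : ∀ x ∈ m, ∀ a : B,
        ∃ c ∈ Submodule.span K ((Finset.image₂ (· * ·) g s : Finset B) : Set B),
          a * x - c ∈ m ^ (n + 1) := by
      intro x hx
      rw [← hg] at hx
      induction hx using Submodule.span_induction with
      | mem x hx =>
        intro a
        obtain ⟨c, hc, hac⟩ := hs a
        refine ⟨x * c, ?_, ?_⟩
        · have := Submodule.mem_map_of_mem (f := LinearMap.mulLeft K x) hc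
          rw [Submodule.map_span] at this
          refine Submodule.span_mono ?_ this
          rintro _ ⟨y, hy, rfl⟩
          exact Finset.mem_coe.2 (Finset.mem_image₂_of_mem hx hy)
        · rw [pow_succ, mul_comm x c, ← sub_mul]
          exact Ideal.mul_mem_mul hac (hg ▸ Submodule.subset_span hx)
      | zero => exact fun a => ⟨0, by simp, by simp⟩
      | add x y _ _ hx hy =>
        intro a
        obtain ⟨c, hc, hxc⟩ := hx a
        obtain ⟨d, hd, hyd⟩ := hy a
        refine ⟨c + d, add_mem hc hd, ?_⟩
        rw [mul_add, add_sub_add_comm]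
        exact add_mem hxc hyd
      | smul r x _ hx =>
        intro a
        obtain ⟨c, hc, hxc⟩ := hx (a * r)
        exact ⟨c, hc, by rwa [smul_eq_mul, ← mul_assoc]⟩
    obtain ⟨k, hk⟩ := hres b
    obtain ⟨c, hc, hbc⟩ := hm _ hk 1
    refine ⟨algebraMap K B k + c, add_mem ?_ ?_, by rwa [← sub_sub, ← one_mul (b - _)]⟩
    · rw [Algebra.algebraMap_eq_smul_one]
      exact Submodule.smul_mem _ _ (Submodule.subset_span (by simp))
    · exact Submodule.span_mono (by simp) hc

theorem powerSeries_module_finite {K B : Type*} [Field K] [CommRing B] [IsNoetherianRing B]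
    [IsLocalRing B] [Algebra K B] [Algebra (PowerSeries K) B] [IsScalarTower K (PowerSeries K) B]
    (hX : algebraMap (PowerSeries K) B PowerSeries.X ∈ IsLocalRing.maximalIdeal B)
    (hres : ∀ b : B, ∃ k : K, b - algebraMap K B k ∈ IsLocalRing.maximalIdeal B) {N : ℕ}
    (hN : IsLocalRing.maximalIdeal B ^ N ≤
      Ideal.span {algebraMap (PowerSeries K) B PowerSeries.X}) :
    Module.Finite (PowerSeries K) B := by
  obtain ⟨s, hs⟩ := exists_finite_span_sup_pow _ hres N
  let I : Ideal (PowerSeries K) := Ideal.span {PowerSeries.X}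
  have hI (n : ℕ) : ∀ b, b ∈ (I ^ n • ⊤ : Submodule (PowerSeries K) B) ↔
      b ∈ Ideal.span {algebraMap (PowerSeries K) B PowerSeries.X} ^ n := by
    intro b
    have := Ideal.smul_top_eq_map (R := PowerSeries K) (S := B) (I ^ n)
    rw [this, Submodule.restrictScalars_mem, Ideal.map_pow, Ideal.map_span, Set.image_singleton]
  have : IsHausdorff I B := ⟨fun x hx => by
    have h2 := Ideal.iInf_pow_eq_bot_of_isLocalRing (IsLocalRing.maximalIdeal B)
      (Ideal.IsPrime.ne_top inferInstance)
    rw [← Ideal.mem_bot, ← h2, Ideal.mem_iInf]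
    intro n
    have := (hI n x).1 (by simpa [SModEq.zero] using hx n)
    exact Ideal.pow_right_mono ((Ideal.span_singleton_le_iff_mem _).2 hX) n this⟩
  have : IsPrecomplete I (s → PowerSeries K) := isPrecomplete_pi I
  let f : (s → PowerSeries K) →ₗ[PowerSeries K] B :=
    Fintype.linearCombination _ (fun i : s => (i : B))
  refine Module.Finite.of_surjective f (surjective_of_mkQ_comp_surjective (I := I) ?_)
  intro b
  obtain ⟨b, rfl⟩ := Submodule.mkQ_surjective _ b
  obtain ⟨c, hc, hbc⟩ := hs b
  have hcf : c ∈ LinearMap.range f := by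
    rw [Fintype.range_linearCombination]
    have := Submodule.span_le_restrictScalars K (PowerSeries K) (s : Set B) hc
    simpa using this
  obtain ⟨x, rfl⟩ := hcf
  refine ⟨x, ?_⟩
  rw [LinearMap.comp_apply, eq_comm, ← sub_eq_zero, ← map_sub, Submodule.mkQ_apply,
    Submodule.Quotient.mk_eq_zero]
  simpa using (hI 1 _).2 (by simpa using hN hbc)

theorem exists_derivation_extending {K A L : Type*} [Field K] [CharZero K] [CommRing A] [IsDomain A]
    [Algebra K A] [Field L] [Algebra K L] [Algebra A L] [IsScalarTower K A L]
    [FaithfulSMul A L] [Algebra.IsAlgebraic A L] (d : Derivation K A A) :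
    ∃ D : Derivation K L L, ∀ a, D (algebraMap A L a) = algebraMap A L (d a) := by
  let F := FractionRing A
  let _ : Algebra F L := FractionRing.liftAlgebra A L
  have : IsScalarTower A F L := FractionRing.isScalarTower_liftAlgebra A L
  have : CharZero A := charZero_of_injective_algebraMap (FaithfulSMul.algebraMap_injective K A)
  have : CharZero F := charZero_of_injective_algebraMap (IsFractionRing.injective A F)
  have : Algebra.IsAlgebraic F L :=
    (IsFractionRing.comap_isAlgebraic_iff (A := A) (K := F)).1 inferInstance
  have : Algebra.FormallyEtale F L := Algebra.FormallyEtale.of_isSeparable F L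
  have : Algebra.FormallyEtale A F := Algebra.FormallyEtale.of_isLocalization (nonZeroDivisors A)
  have : Algebra.FormallyEtale A L := Algebra.FormallyEtale.comp A F L
  let d' : Derivation K A L := (Algebra.linearMap A L).compDer d
  have hbc := KaehlerDifferential.isBaseChange_of_formallyEtale K A L
  refine ⟨(hbc.lift d'.liftKaehlerDifferential).compDer (KaehlerDifferential.D K L), fun a => ?_⟩
  have := hbc.lift_eq d'.liftKaehlerDifferential (KaehlerDifferential.D K A a)
  simpa [d'] using this

theorem exists_fg_forall_derivation_mem {K A B L : Type*} [CommRing K] [CommRing A] [CommRing B]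
    [CommRing L] [Algebra K A] [Algebra K B] [Algebra K L] [Algebra A B] [Algebra B L] [Algebra A L]
    [IsScalarTower A B L] [IsScalarTower K A B] [Module.Finite A B] (D : Derivation K B L)
    (hD : ∀ a : A, D (algebraMap A B a) ∈ (1 : Submodule B L)) :
    ∃ M : Submodule B L, M.FG ∧ ∀ b, D b ∈ M := by
  classical
  obtain ⟨s, hs⟩ := (Module.Finite.fg_top : (⊤ : Submodule A B).FG)
  refine ⟨Submodule.span B (insert 1 (s.image D) : Finset L), ⟨_, rfl⟩, fun b => ?_⟩
  have hb : b ∈ Submodule.span A (s : Set B) := hs ▸ trivial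
  induction hb using Submodule.span_induction with
  | mem x hx => exact Submodule.subset_span (by simp; right; exact ⟨x, hx, rfl⟩)
  | zero => simp
  | add x y _ _ hx hy => rw [map_add]; exact add_mem hx hy
  | smul a x _ hx =>
    rw [Algebra.smul_def, D.leibniz]
    refine add_mem (Submodule.smul_mem _ _ hx) (Submodule.smul_mem _ _ ?_)
    refine (Submodule.span_mono ?_ : Submodule.span B {(1 : L)} ≤ _) ?_
    · simp
    · rw [← Submodule.one_eq_span]; exact hD a

theorem derivation_mem_pow_smul {K S L : Type*} [CommRing K] [CommRing S] [Algebra K S]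
    [AddCommGroup L] [Module S L] [Module K L]
    (E : Derivation K S L) (N : Submodule S L) (hN : ∀ s, E s ∈ N) (m : Ideal S) (n : ℕ) :
    ∀ x ∈ m ^ (n + 1), E x ∈ m ^ n • N := by
  induction n with
  | zero => intro x _; simpa using hN x
  | succ n ih =>
    intro x hx
    rw [pow_succ] at hx
    induction hx using Submodule.mul_induction_on' with
    | mem_mul_mem x hx y hy =>
      rw [E.leibniz]
      refine add_mem (Submodule.smul_mem_smul hx (hN y)) ?_
      rw [pow_succ', ← smul_eq_mul, Submodule.smul_assoc]
      exact Submodule.smul_mem_smul hy (ih x hx)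
    | add x _ y _ hx hy => rw [map_add]; exact add_mem hx hy

open MvPowerSeries in
theorem MvPowerSeries.mem_span_X_pow_of_sub {σ K : Type*} [Finite σ] [CommRing K] (n : ℕ)
    (s : MvPowerSeries σ K) :
    s - (truncTotal n s : MvPolynomial σ K) ∈
        (Ideal.span (Set.range X) : Ideal (MvPowerSeries σ K)) ^ n := by
  set I : Ideal (MvPowerSeries σ K) := Ideal.span (Set.range X)
  have hI : (MvPolynomial.idealOfVars σ K).map (MvPolynomial.coeToMvPowerSeries.ringHom) = I := by
    rw [Ideal.map_span, ← Set.range_comp]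
    congr 2; ext1; simp
  obtain ⟨t, ht⟩ := IsPrecomplete.prec (inferInstance : IsPrecomplete I (MvPowerSeries σ K))
    (f := fun k => (truncTotal k s : MvPowerSeries σ K)) (by
      intro k l hkl
      rw [SModEq.sub_mem, smul_eq_mul, Ideal.mul_top, ← hI, ← Ideal.map_pow]
      have := Ideal.mem_map_of_mem MvPolynomial.coeToMvPowerSeries.ringHom
        (truncTotal_sub_truncTotal_mem_pow_idealOfVars le_rfl hkl s)
      rwa [map_sub] at this)
  have hord : ∀ k : ℕ, ∀ u ∈ I ^ k, (k : ℕ∞) ≤ u.order := by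
    intro k
    induction k with
    | zero => simp
    | succ k ih =>
      intro u hu
      rw [pow_succ] at hu
      induction hu using Submodule.mul_induction_on' with
      | mem_mul_mem x hx y hy =>
        refine le_trans ?_ le_order_mul
        push_cast
        refine add_le_add (ih x hx) (one_le_order_iff_constCoeff_eq_zero.2 ?_)
        have : I ≤ RingHom.ker (constantCoeff (σ := σ) (R := K)) := by
          rw [Ideal.span_le]; rintro _ ⟨i, rfl⟩; simp
        exact this hy
      | add x _ y _ hx hy => exact (le_min hx hy).trans min_order_le_add
  have hts : t = s := by
    ext d
    have h1 := hord (d.degree + 1) _ (by simpa [SModEq.sub_mem] using ht (d.degree + 1))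
    have h2 :=
        coeff_of_lt_order (f := (truncTotal (d.degree + 1) s : MvPowerSeries σ K) - t) (d := d)
      (lt_of_lt_of_le (by exact_mod_cast Nat.lt_succ_self _) h1)
    rw [map_sub, MvPolynomial.coeff_coe, coeff_truncTotal _ (Nat.lt_succ_self _), sub_eq_zero] at h2
    exact h2.symm
  have := ht n
  rw [SModEq.sub_mem, smul_eq_mul, Ideal.mul_top, hts] at this
  rw [← neg_sub]
  exact neg_mem this

open MvPowerSeries in
theorem MvPowerSeries.derivation_eq_zero {σ K L : Type*} [Finite σ] [Field K] [AddCommGroup L]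
    [Module (MvPowerSeries σ K) L] [Module K L] [IsScalarTower K (MvPowerSeries σ K) L]
    (E : Derivation K (MvPowerSeries σ K) L)
    (N : Submodule (MvPowerSeries σ K) L) (hfg : N.FG) (hN : ∀ s, E s ∈ N)
    (hX : ∀ i, E (X i) = 0) : E = 0 := by
  set I : Ideal (MvPowerSeries σ K) := Ideal.span (Set.range X) with hIdef
  have hpoly : ∀ p : MvPolynomial σ K, E (p : MvPowerSeries σ K) = 0 := by
    intro p
    induction p using MvPolynomial.induction_on with
    | C a =>
      rw [MvPolynomial.coe_C]
      exact E.map_algebraMap a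
    | add p q hp hq => rw [MvPolynomial.coe_add, map_add, hp, hq, add_zero]
    | mul_X p i hp => rw [MvPolynomial.coe_mul, E.leibniz, hp, MvPolynomial.coe_X, hX]; simp
  have hItop : I ≠ ⊤ := by
    have : I ≤ RingHom.ker (constantCoeff (σ := σ) (R := K)) := by
      rw [Ideal.span_le]; rintro _ ⟨i, rfl⟩; simp
    exact ne_top_of_le_ne_top (RingHom.ker_ne_top _) this
  ext s
  have : Module.Finite (MvPowerSeries σ K) N := Module.Finite.iff_fg.2 hfg
  have hk := Ideal.iInf_pow_smul_eq_bot_of_isLocalRing (R := MvPowerSeries σ K) (M := N) I hItop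
  have hmem : (⟨E s, hN s⟩ : N) ∈ (⨅ n : ℕ, I ^ n • ⊤ : Submodule (MvPowerSeries σ K) N) := by
    rw [Submodule.mem_iInf]
    intro n
    have h1 := derivation_mem_pow_smul E N hN I n _ (mem_span_X_pow_of_sub (n + 1) s)
    rw [map_sub, hpoly, sub_zero] at h1
    have := Submodule.map_smul'' (I ^ n) (⊤ : Submodule (MvPowerSeries σ K) N) N.subtype
    rw [Submodule.map_top, Submodule.range_subtype] at this
    rw [← this] at h1
    obtain ⟨y, hy, hys⟩ := h1
    have : y = ⟨E s, hN s⟩ := Subtype.ext hys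
    exact this ▸ hy
  rw [hk, Submodule.mem_bot] at hmem
  exact congrArg Subtype.val hmem

open MvPowerSeries in
theorem MvPowerSeries.exists_prime_derivation {σ K : Type*} [Fintype σ] [Field K] [CharZero K]
    {h u : MvPowerSeries σ K} (hu : constantCoeff u = 0) (huh : u ∣ h)
    {J : Ideal (MvPowerSeries σ K)} (hJ : h ∉ J.radical) :
    ∃ p : Ideal (MvPowerSeries σ K), p.IsPrime ∧ J ≤ p ∧ h ∉ p ∧
      ∃ a : σ → FractionRing (MvPowerSeries σ K ⧸ p),
        (∀ s ∈ p, ∑ i, pderiv K i s • a i = 0) ∧ ∑ i, pderiv K i u • a i = 1 := by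
  obtain ⟨p, hp⟩ := exists_maximal_of_wellFoundedGT
    (fun q : Ideal (MvPowerSeries σ K) => q.IsPrime ∧ J ≤ q ∧ h ∉ q) (by
      rw [Ideal.radical_eq_sInf, Ideal.mem_sInf] at hJ
      push Not at hJ
      obtain ⟨q, ⟨hJq, hq⟩, hhq⟩ := hJ
      exact ⟨q, hq, hJq, hhq⟩)
  obtain ⟨hpp, hJp, hhp⟩ := hp.prop
  refine ⟨p, hpp, hJp, hhp, ?_⟩
  let B := MvPowerSeries σ K ⧸ p
  let L := FractionRing B
  have hloc : IsLocalRing B := IsLocalRing.of_surjective' _ (Ideal.Quotient.mk_surjective (I := p))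
  have hup : u ∉ p := fun hup => hhp (p.mem_of_dvd huh hup)
  have hmB (s : MvPowerSeries σ K) (hs : constantCoeff s = 0) :
      Ideal.Quotient.mk p s ∈ IsLocalRing.maximalIdeal B := by
    rw [IsLocalRing.mem_maximalIdeal, mem_nonunits_iff]
    intro hunit
    have : IsLocalHom (Ideal.Quotient.mk p) :=
      IsLocalHom.of_surjective _ Ideal.Quotient.mk_surjective
    have h1 := isUnit_iff_constantCoeff.1 (isUnit_of_map_unit (Ideal.Quotient.mk p) s hunit)
    simp [hs] at h1
  have hdim : ∀ q : Ideal B, q.IsPrime → q ≠ ⊥ → q = IsLocalRing.maximalIdeal B := by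
    intro q hq hq0
    refine eq_maximalIdeal_of_forall_prime_mem (h := Ideal.Quotient.mk p h) ?_ ?_ ?_ q hq0
    · refine hmB h ?_
      obtain ⟨v, rfl⟩ := huh
      simp [hu]
    · intro r hr hr0
      by_contra hhr
      have hle : p ≤ r.comap (Ideal.Quotient.mk p) := by
        intro s hs
        rw [Ideal.mem_comap, Ideal.Quotient.eq_zero_iff_mem.2 hs]
        exact r.zero_mem
      have hpr := hp.eq_of_le ⟨inferInstance, hJp.trans hle, hhr⟩ hle
      refine hr0 (eq_bot_iff.2 fun b hb => ?_)
      obtain ⟨s, rfl⟩ := Ideal.Quotient.mk_surjective b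
      have hs : s ∈ p := by rw [hpr]; exact hb
      rw [Ideal.mem_bot, Ideal.Quotient.eq_zero_iff_mem.2 hs]
    · rwa [Ne, Ideal.Quotient.eq_zero_iff_mem]
  obtain ⟨N, hN⟩ := exists_maximalIdeal_pow_le_span hdim (t := Ideal.Quotient.mk p u)
    (by rwa [Ne, Ideal.Quotient.eq_zero_iff_mem])
  have hsub : PowerSeries.HasSubst u := PowerSeries.HasSubst.of_constantCoeff_zero hu
  let φ : PowerSeries K →ₐ[K] B := (Ideal.Quotient.mkₐ K p).comp
    (PowerSeries.substAlgHom hsub)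
  let _ : Algebra (PowerSeries K) B := φ.toRingHom.toAlgebra
  have : IsScalarTower K (PowerSeries K) B :=
    IsScalarTower.of_algebraMap_eq fun x => (φ.commutes x).symm
  have hφX : algebraMap (PowerSeries K) B PowerSeries.X = Ideal.Quotient.mk p u := by
    change Ideal.Quotient.mk p (PowerSeries.substAlgHom hsub PowerSeries.X) = _
    rw [PowerSeries.coe_substAlgHom, PowerSeries.subst_X hsub]
  have hfin : Module.Finite (PowerSeries K) B := by
    refine powerSeries_module_finite (N := N) (hφX ▸ hmB u hu) ?_ (hφX ▸ hN)
    intro b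
    obtain ⟨s, rfl⟩ := Ideal.Quotient.mk_surjective b
    exact ⟨constantCoeff s, hmB (s - C (constantCoeff s)) (by simp)⟩
  have hinj : Function.Injective (algebraMap (PowerSeries K) B) := by
    rw [injective_iff_map_eq_zero]
    intro f hf
    by_contra hf0
    obtain ⟨n, w, hw⟩ :=
        IsDiscreteValuationRing.associated_pow_irreducible hf0 PowerSeries.X_prime.irreducible
    have := congrArg (algebraMap (PowerSeries K) B) hw
    rw [map_mul, hf, zero_mul, map_pow, hφX, eq_comm] at this
    exact hup (Ideal.Quotient.eq_zero_iff_mem.1 (eq_zero_of_pow_eq_zero this))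
  have : FaithfulSMul (PowerSeries K) B := (faithfulSMul_iff_algebraMap_injective _ _).2 hinj
  have : FaithfulSMul B L :=
    (faithfulSMul_iff_algebraMap_injective B L).2 (IsFractionRing.injective B L)
  have : FaithfulSMul (PowerSeries K) L := FaithfulSMul.trans (PowerSeries K) B L
  have : Algebra.IsAlgebraic (PowerSeries K) L :=
    (IsFractionRing.isAlgebraic_iff' (PowerSeries K) B L).1 inferInstance
  obtain ⟨D, hD⟩ := exists_derivation_extending (L := L) (PowerSeries.derivative K)
  let DB : Derivation K B L := D.compAlgebraMap B
  obtain ⟨M, hMfg, hM⟩ := exists_fg_forall_derivation_mem (A := PowerSeries K) DB (by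
    intro a
    refine Submodule.mem_one.2 ⟨algebraMap (PowerSeries K) B (PowerSeries.derivative K a), ?_⟩
    rw [← IsScalarTower.algebraMap_apply, ← hD, IsScalarTower.algebraMap_apply _ B L]
    rfl)
  let DS : Derivation K (MvPowerSeries σ K) L := DB.compAlgebraMap (MvPowerSeries σ K)
  let E : Derivation K (MvPowerSeries σ K) L := DS -
    ∑ i, (LinearMap.toSpanSingleton (MvPowerSeries σ K) L (DS (X i))).compDer (pderiv K i)
  have hEs (s : MvPowerSeries σ K) : E s = DS s - ∑ i, pderiv K i s • DS (X i) := by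
    have := congrFun (map_sum (Derivation.coeFnAddMonoidHom (R := K)
        (A := MvPowerSeries σ K) (M := L))
      (fun i => (LinearMap.toSpanSingleton (MvPowerSeries σ K) L (DS (X i))).compDer (pderiv K i))
      Finset.univ) s
    simp only [E, Derivation.sub_apply]
    congr 1
    rw [Finset.sum_apply] at this
    exact this
  have hE : E = 0 := by
    refine derivation_eq_zero E
        (M.restrictScalars _ ⊔ Submodule.span _ (Set.range fun i => DS (X i)))
      (Submodule.FG.sup ?_ (Submodule.fg_span (Set.finite_range _))) (fun s => ?_) (fun j => ?_)
    · exact hMfg.restrictScalars_of_surjective Ideal.Quotient.mk_surjective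
    · rw [hEs]
      refine sub_mem (Submodule.mem_sup_left (hM _)) (Submodule.mem_sup_right ?_)
      exact Submodule.sum_mem _ fun i _ => Submodule.smul_mem _ _
          (Submodule.subset_span (Set.mem_range_self i))
    · rw [hEs, sub_eq_zero, Finset.sum_eq_single j]
      · rw [pderiv_X_self, one_smul]
      · intro i _ hij
        rw [pderiv_X_of_ne hij.symm, zero_smul]
      · exact fun hj => absurd (Finset.mem_univ j) hj
  have hDS (s : MvPowerSeries σ K) : ∑ i, pderiv K i s • DS (X i) = DB (Ideal.Quotient.mk p s) :=
    (sub_eq_zero.1 ((hEs s).symm.trans (by rw [hE]; rfl))).symm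
  refine ⟨fun i => DS (X i), fun s hs => ?_, ?_⟩
  · rw [hDS, Ideal.Quotient.eq_zero_iff_mem.2 hs, map_zero]
  · rw [hDS, ← hφX]
    exact (hD PowerSeries.X).trans (by simp)

open MvPowerSeries in
theorem MvPowerSeries.mul_mem_radical_span {σ K : Type*} [Fintype σ] [Field K] [CharZero K]
    (g : MvPowerSeries σ K) :
    (∑ i, X i ^ 2) * (∑ i, X i * pderiv K i g) ∈ (Ideal.span (insert g (Set.range fun ij : σ × σ =>
      X ij.1 * pderiv K ij.2 g - X ij.2 * pderiv K ij.1 g))).radical := by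
  set u : MvPowerSeries σ K := ∑ i, X i ^ 2 with hudef
  set e : MvPowerSeries σ K := ∑ i, X i * pderiv K i g with hedef
  set J := Ideal.span (insert g (Set.range fun ij : σ × σ =>
      X ij.1 * pderiv K ij.2 g - X ij.2 * pderiv K ij.1 g)) with hJ
  by_contra hne
  obtain ⟨p, hp, hJp, hhp, a, ha, hau⟩ := exists_prime_derivation (u := u)
    (by simp [hudef, map_sum]) (Dvd.intro _ rfl) hne
  have hu : ∀ i, pderiv K i u = 2 * X i := by
    classical
    intro i
    rw [hudef, map_sum, Finset.sum_eq_single i]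
    · rw [Derivation.leibniz_pow, pderiv_X_self]
      simp [two_mul]
    · intro j _ hj
      rw [Derivation.leibniz_pow, pderiv_X_of_ne hj]
      simp
    · simp
  have hg := ha g (hJp (Ideal.subset_span (Set.mem_insert _ _)))
  have hmem : ∀ j, u * pderiv K j g - X j * e ∈ p := by
    intro j
    have : u * pderiv K j g - X j * e =
        ∑ i, X i * (X i * pderiv K j g - X j * pderiv K i g) := by
      simp only [hudef, hedef, Finset.sum_mul, Finset.mul_sum, ← Finset.sum_sub_distrib]
      exact Finset.sum_congr rfl fun i _ => by ring
    rw [this]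
    exact Ideal.sum_mem _ fun i _ => Ideal.mul_mem_left _ _
      (hJp (Ideal.subset_span (Set.mem_insert_of_mem _ ⟨(i, j), rfl⟩)))
  let L := FractionRing (MvPowerSeries σ K ⧸ p)
  have hker : ∀ s : MvPowerSeries σ K, algebraMap (MvPowerSeries σ K) L s = 0 → s ∈ p := by
    intro s hs
    rw [IsScalarTower.algebraMap_apply _ (MvPowerSeries σ K ⧸ p) L,
      FaithfulSMul.algebraMap_eq_zero_iff] at hs
    exact Ideal.Quotient.eq_zero_iff_mem.1 hs
  have hker' : ∀ s ∈ p, algebraMap (MvPowerSeries σ K) L s = 0 := by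
    intro s hs
    rw [IsScalarTower.algebraMap_apply _ (MvPowerSeries σ K ⧸ p) L, Ideal.Quotient.algebraMap_eq,
      Ideal.Quotient.eq_zero_iff_mem.2 hs, map_zero]
  refine hhp (p.mul_mem_left u (hker e ?_))
  simp only [Algebra.smul_def] at hg hau
  have h1 : ∀ j, algebraMap (MvPowerSeries σ K) L u * algebraMap _ L (pderiv K j g) =
      algebraMap _ L (X j) * algebraMap _ L e := fun j => by
    rw [← map_mul, ← map_mul, ← sub_eq_zero, ← map_sub]
    exact hker' _ (hmem j)
  calc algebraMap (MvPowerSeries σ K) L e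
      = algebraMap (MvPowerSeries σ K) L e * ∑ i, algebraMap _ L (pderiv K i u) * a i := by
        rw [hau, mul_one]
    _ = 2 * ∑ i, (algebraMap _ L (X i) * algebraMap _ L e) * a i := by
        simp only [hu, map_mul, Finset.mul_sum, map_ofNat]
        exact Finset.sum_congr rfl fun i _ => by ring
    _ = 2 * (algebraMap _ L u * ∑ i, algebraMap _ L (pderiv K i g) * a i) := by
        simp only [← h1, mul_assoc]
        exact congrArg _ (Finset.mul_sum _ _ _).symm
    _ = 0 := by rw [hg]; simp

section

open Asymptotics

theorem MvPolynomial.hasFDerivAt_eval {ι : Type*} [Fintype ι] (P : MvPolynomial ι ℝ)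
    (x : EuclideanSpace ℝ ι) :
    HasFDerivAt (fun y : EuclideanSpace ℝ ι => MvPolynomial.eval y.ofLp P)
      (∑ i, MvPolynomial.eval x.ofLp (MvPolynomial.pderiv i P) •
        EuclideanSpace.proj (𝕜 := ℝ) i) x := by
  classical
  induction P using MvPolynomial.induction_on with
  | C a => simpa using hasFDerivAt_const a x
  | add p q hp hq =>
    simp only [map_add]
    exact (hp.add hq).congr_fderiv (by simp [add_smul, Finset.sum_add_distrib])
  | mul_X p j hp =>
    have hj : HasFDerivAt (fun y : EuclideanSpace ℝ ι => y.ofLp j)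
        (EuclideanSpace.proj (𝕜 := ℝ) j) x :=
      (EuclideanSpace.proj (𝕜 := ℝ) j).hasFDerivAt
    simp only [map_mul, MvPolynomial.eval_X]
    refine (hp.mul hj).congr_fderiv ?_
    simp only [Derivation.leibniz, MvPolynomial.pderiv_X, smul_eq_mul, map_add, map_mul,
      MvPolynomial.eval_X, add_smul, Finset.sum_add_distrib, Finset.smul_sum, smul_smul]
    congr 1
    rw [Finset.sum_eq_single j]
    · simp
    · intro i _ hij
      simp [hij.symm]
    · simp

theorem MvPolynomial.isBigO_eval_one {ι : Type*} [Fintype ι] (P : MvPolynomial ι ℝ) :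
    (fun x : EuclideanSpace ℝ ι => MvPolynomial.eval x.ofLp P) =O[𝓝 0] (fun _ => (1 : ℝ)) :=
  (P.hasFDerivAt_eval 0).continuousAt.isBigO_one ℝ

theorem MvPolynomial.isBigO_eval {ι : Type*} [Fintype ι] (n : ℕ) :
    ∀ P ∈ MvPolynomial.idealOfVars ι ℝ ^ n,
    (fun x : EuclideanSpace ℝ ι => MvPolynomial.eval x.ofLp P) =O[𝓝 0] (fun x => ‖x‖ ^ n) := by
  induction n with
  | zero => intro P _; simpa using P.isBigO_eval_one
  | succ n ih =>
    intro P hP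
    rw [pow_succ] at hP
    induction hP using Submodule.mul_induction_on' with
    | mem_mul_mem p hp q hq =>
      simp only [map_mul, pow_succ]
      refine (ih p hp).mul ?_
      induction hq using Submodule.span_induction with
      | mem x hx =>
        obtain ⟨i, rfl⟩ := hx
        simp only [MvPolynomial.eval_X]
        exact isBigO_of_le _ fun x => by simpa using PiLp.norm_apply_le x i
      | zero => simpa using isBigO_zero _ _
      | add x y _ _ hx hy => simpa using hx.add hy
      | smul a x _ hx => simpa using a.isBigO_eval_one.mul hx
    | add p _ q _ hp hq => simpa using hp.add hq

/-- The power series `s` is congruent modulo order `M` to the germ of `φ` at the origin. -/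
def HasExpansion {ι : Type*} [Fintype ι] (M : ℕ) (φ : EuclideanSpace ℝ ι → ℝ)
    (s : MvPowerSeries ι ℝ) : Prop :=
  (fun x => φ x - MvPolynomial.eval x.ofLp (s.truncTotal M)) =O[𝓝 0] fun x => ‖x‖ ^ M

namespace HasExpansion

variable {ι : Type*} [Fintype ι] {M : ℕ} {φ ψ : EuclideanSpace ℝ ι → ℝ} {s t : MvPowerSeries ι ℝ}

theorem add (hφ : HasExpansion M φ s) (hψ : HasExpansion M ψ t) :
    HasExpansion M (fun x => φ x + ψ x) (s + t) :=
  (IsBigO.add hφ hψ).congr_left fun x => by simp only [map_add]; ring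

theorem sub (hφ : HasExpansion M φ s) (hψ : HasExpansion M ψ t) :
    HasExpansion M (fun x => φ x - ψ x) (s - t) :=
  (IsBigO.sub hφ hψ).congr_left fun x => by simp only [map_sub]; ring

theorem eval_truncTotal (M : ℕ) (s : MvPowerSeries ι ℝ) :
    HasExpansion M (fun x => MvPolynomial.eval x.ofLp (s.truncTotal M)) s := by
  simpa [HasExpansion] using isBigO_zero _ _

theorem isBigO_one (hφ : HasExpansion M φ s) : φ =O[𝓝 0] fun _ => (1 : ℝ) := by
  have h1 : (fun x : EuclideanSpace ℝ ι => ‖x‖ ^ M) =O[𝓝 0] fun _ => (1 : ℝ) :=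
    ((continuous_norm.pow M).continuousAt).isBigO_one ℝ
  simpa using (IsBigO.trans hφ h1).add (s.truncTotal M).isBigO_eval_one

theorem mul (hφ : HasExpansion M φ s) (hψ : HasExpansion M ψ t) :
    HasExpansion M (fun x => φ x * ψ x) (s * t) := by
  have h1 := (hφ.isBigO_one.mul hψ).congr_right fun x => one_mul _
  have h2 := (IsBigO.mul hφ (t.truncTotal M).isBigO_eval_one).congr_right fun x => mul_one _
  have h3 := MvPolynomial.isBigO_eval M _
    (MvPowerSeries.truncTotal_mul_sub_mul_truncTotal_mem_pow_idealOfVars s t)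
  refine ((h1.add h2).sub h3).congr_left fun x => ?_
  simp only [map_sub, map_mul]
  ring

theorem coe (M : ℕ) (P : MvPolynomial ι ℝ) :
    HasExpansion M (fun x => MvPolynomial.eval x.ofLp P) P := by
  have : P - MvPowerSeries.truncTotal M (P : MvPowerSeries ι ℝ) ∈
      MvPolynomial.idealOfVars ι ℝ ^ M := by
    rw [MvPolynomial.mem_pow_idealOfVars_iff']
    intro d hd
    rw [MvPolynomial.coeff_sub, MvPowerSeries.coeff_truncTotal _ hd, MvPolynomial.coeff_coe,
      sub_self]
  exact (MvPolynomial.isBigO_eval M _ this).congr_left fun x => by simp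

theorem X (M : ℕ) (i : ι) : HasExpansion M (fun x => x.ofLp i) (MvPowerSeries.X i) := by
  simpa using coe M (MvPolynomial.X i)

theorem sum {κ : Type*} (S : Finset κ) {Φ : κ → EuclideanSpace ℝ ι → ℝ} {s : κ → MvPowerSeries ι ℝ}
    (h : ∀ i ∈ S, HasExpansion M (Φ i) (s i)) :
    HasExpansion M (fun x => ∑ i ∈ S, Φ i x) (∑ i ∈ S, s i) :=
  (IsBigO.sum h).congr_left fun x => by simp

theorem pow (hφ : HasExpansion M φ s) (N : ℕ) : HasExpansion M (fun x => φ x ^ N) (s ^ N) := by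
  induction N with
  | zero => simpa using coe M (1 : MvPolynomial ι ℝ)
  | succ N ih => simpa only [pow_succ] using ih.mul hφ

theorem exists_of_mem_span {T : Set (MvPowerSeries ι ℝ)} {Z : Set (EuclideanSpace ℝ ι)}
    (hT : ∀ s ∈ T, ∃ φ, HasExpansion M φ s ∧ ∀ x ∈ Z, φ x = 0)
    (hs : s ∈ Ideal.span T) : ∃ φ, HasExpansion M φ s ∧ ∀ x ∈ Z, φ x = 0 := by
  induction hs using Submodule.span_induction with
  | mem s hs => exact hT s hs
  | zero =>
    exact ⟨fun _ => 0, by simpa using eval_truncTotal M (0 : MvPowerSeries ι ℝ), fun _ _ => rfl⟩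
  | add s t _ _ hs ht =>
    obtain ⟨φ, hφ, hφZ⟩ := hs
    obtain ⟨ψ, hψ, hψZ⟩ := ht
    exact ⟨_, hφ.add hψ, fun x hx => by simp [hφZ x hx, hψZ x hx]⟩
  | smul a s _ hs =>
    obtain ⟨φ, hφ, hφZ⟩ := hs
    exact ⟨_, (eval_truncTotal M a).mul hφ, fun x hx => by simp [hφZ x hx]⟩

theorem isBigO_sub (hφ : HasExpansion M φ s) (hψ : HasExpansion M ψ s) :
    (fun x => φ x - ψ x) =O[𝓝 0] fun x => ‖x‖ ^ M :=
  (IsBigO.sub hφ hψ).congr_left fun x => by ring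

end HasExpansion

open MvPowerSeries in
theorem MvPowerSeries.truncTotal_pderiv {ι R : Type*} [Finite ι] [CommRing R] (M : ℕ) (i : ι)
    (s : MvPowerSeries ι R) :
    truncTotal M (pderiv R i s) = MvPolynomial.pderiv i (truncTotal (M + 1) s) := by
  ext d
  rw [MvPolynomial.coeff_pderiv, coeff_truncTotal_eq_ite, coeff_truncTotal_eq_ite, coeff_pderiv]
  simp

theorem ContinuousMultilinearMap.exists_isHomogeneous_eval_eq {ι : Type*} [Fintype ι] {k : ℕ}
    (p : ContinuousMultilinearMap ℝ (fun _ : Fin k => EuclideanSpace ℝ ι) ℝ) :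
    ∃ P : MvPolynomial ι ℝ, P.IsHomogeneous k ∧
      ∀ x : EuclideanSpace ℝ ι, MvPolynomial.eval x.ofLp P = p fun _ => x := by
  classical
  refine ⟨∑ v : Fin k → ι, MvPolynomial.C (p fun j => EuclideanSpace.single (v j) 1) *
    ∏ j, MvPolynomial.X (v j), ?_, fun x => ?_⟩
  · refine MvPolynomial.IsHomogeneous.sum _ _ _ fun v _ => MvPolynomial.IsHomogeneous.C_mul ?_ _
    simpa using MvPolynomial.IsHomogeneous.prod Finset.univ (fun j => MvPolynomial.X (R := ℝ) (v j))
      (fun _ => 1) fun j _ => MvPolynomial.isHomogeneous_X _ _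
  · have hx : x = ∑ i, x.ofLp i • EuclideanSpace.single i (1 : ℝ) := by
      ext j
      simp [Finset.sum_apply, Pi.single_apply]
    conv_rhs => rw [hx, ContinuousMultilinearMap.map_sum]
    rw [_root_.map_sum]
    refine Finset.sum_congr rfl fun v _ => ?_
    rw [ContinuousMultilinearMap.map_smul_univ]
    simp [mul_comm]

theorem HasFPowerSeriesOnBall.isBigO_of_forall_lt_eq_zero {E F : Type*} [NormedAddCommGroup E]
    [NormedSpace ℝ E] [NormedAddCommGroup F] [NormedSpace ℝ F] {f : E → F}
    {p : FormalMultilinearSeries ℝ E F} {r : ENNReal} (hf : HasFPowerSeriesOnBall f p 0 r) {M : ℕ}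
    (hp : ∀ k < M, p k = 0) : f =O[𝓝 0] fun x => ‖x‖ ^ M := by
  refine (hf.hasFPowerSeriesAt.isBigO_sub_partialSum_pow M).congr_left fun x => ?_
  rw [zero_add, FormalMultilinearSeries.partialSum, Finset.sum_eq_zero, sub_zero]
  intro k hk
  rw [hp k (Finset.mem_range.1 hk)]
  rfl

open MvPowerSeries in
theorem AnalyticAt.exists_hasExpansion {ι : Type*} [Fintype ι] [DecidableEq ι]
    {g : EuclideanSpace ℝ ι → ℝ} (hg : AnalyticAt ℝ g 0) :
    ∃ s : MvPowerSeries ι ℝ, ∀ M, HasExpansion M g s ∧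
      ∀ i, HasExpansion M (fun x => fderiv ℝ g x (EuclideanSpace.single i 1)) (pderiv ℝ i s) := by
  have hdiff : ∀ᶠ x in 𝓝 0, DifferentiableAt ℝ g x :=
    hg.eventually_analyticAt.mono fun x hx => hx.differentiableAt
  obtain ⟨p, r, hp⟩ := hg
  choose P hPhom hP using fun k => (p k).exists_isHomogeneous_eval_eq
  let s : MvPowerSeries ι ℝ := fun d => (P d.degree).coeff d
  have hs (M : ℕ) : truncTotal M s = ∑ k ∈ Finset.range M, P k := by
    ext d
    rw [coeff_truncTotal_eq_ite, MvPolynomial.coeff_sum]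
    have h0 : ∀ k, k ≠ d.degree → (P k).coeff d = 0 := fun k hk =>
      (hPhom k).coeff_eq_zero (Ne.symm hk)
    split_ifs with hd
    · rw [Finset.sum_eq_single d.degree (fun k _ hk => h0 k hk)
        (fun h => absurd (Finset.mem_range.2 hd) h)]
      rfl
    · exact (Finset.sum_eq_zero fun k hk => h0 k fun h => hd (h ▸ Finset.mem_range.1 hk)).symm
  let T (M : ℕ) (x : EuclideanSpace ℝ ι) : ℝ := MvPolynomial.eval x.ofLp (truncTotal M s)
  have hrem (M : ℕ) : ∃ q : FormalMultilinearSeries ℝ (EuclideanSpace ℝ ι) ℝ,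
      HasFPowerSeriesOnBall (g - T M) q 0 r ∧ ∀ k < M, q k = 0 := by
    let q : FormalMultilinearSeries ℝ (EuclideanSpace ℝ ι) ℝ := fun k => if k < M then p k else 0
    have hq : HasFPowerSeriesOnBall (T M) q 0 r := by
      refine ⟨?_, hp.r_pos, fun {y} _ => ?_⟩
      · rw [q.radius_eq_top_of_forall_image_add_eq_zero M fun m => by simp [q]]
        exact le_top
      · have : T M (0 + y) = ∑ k ∈ Finset.range M, q k fun _ => y := by
          simp only [T, hs, zero_add, map_sum, hP]
          exact Finset.sum_congr rfl fun k hk => by simp [q, Finset.mem_range.1 hk]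
        rw [this]
        refine hasSum_sum_of_ne_finset_zero fun k hk => ?_
        simp [q, Finset.mem_range.not.1 hk]
    refine ⟨p - q, hp.sub hq, fun k hk => ?_⟩
    have : q k = p k := if_pos hk
    exact sub_eq_zero.2 this.symm
  refine ⟨s, fun M => ⟨?_, fun i => ?_⟩⟩
  · obtain ⟨q, hq, hq0⟩ := hrem M
    exact hq.isBigO_of_forall_lt_eq_zero hq0
  · obtain ⟨q, hq, hq0⟩ := hrem (M + 1)
    have h1 := hq.fderiv.isBigO_of_forall_lt_eq_zero (M := M) fun k hk =>
      q.derivSeries_eq_zero (hq0 (k + 1) (by lia))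
    have h2 : (fun x => fderiv ℝ (g - T (M + 1)) x (EuclideanSpace.single i 1)) =O[𝓝 0]
        fun x => ‖x‖ ^ M :=
      (IsBigO.of_bound 1 (Filter.Eventually.of_forall fun x => by
        simpa using (fderiv ℝ (g - T (M + 1)) x).le_opNorm (EuclideanSpace.single i 1))).trans h1
    refine h2.congr' ?_ Filter.EventuallyEq.rfl
    filter_upwards [hdiff] with x hx
    have hT := (truncTotal (M + 1) s).hasFDerivAt_eval x
    rw [(hx.hasFDerivAt.sub hT).fderiv, truncTotal_pderiv, sub_apply]
    congr 1
    simp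

end

theorem AnalyticAt.eventually_norm_gradient_lt {ι : Type*} [Fintype ι]
    {g : EuclideanSpace ℝ ι → ℝ} (hg : AnalyticAt ℝ g 0) (m : ℕ) :
    ∀ᶠ x in 𝓝 0, x ≠ 0 → g x = 0 → (∃ t : ℝ, gradient g x = t • x) →
      ‖gradient g x‖ < ‖x‖ ^ m := by
  classical
  obtain ⟨s, hs⟩ := hg.exists_hasExpansion
  obtain ⟨N, hN⟩ := MvPowerSeries.mul_mem_radical_span s
  let M := (m + 3) * N + 1
  let Z : Set (EuclideanSpace ℝ ι) := {x | g x = 0 ∧ ∃ t : ℝ, gradient g x = t • x}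
  have hgrad (x : EuclideanSpace ℝ ι) (i : ι) :
      fderiv ℝ g x (EuclideanSpace.single i 1) = (gradient g x).ofLp i := by
    rw [← toDual_gradient, InnerProductSpace.toDual_apply_apply, EuclideanSpace.inner_single_right]
    simp
  have hD (i : ι) : HasExpansion M (fun x => (gradient g x).ofLp i)
      (MvPowerSeries.pderiv ℝ i s) := by
    simpa only [hgrad] using (hs M).2 i
  obtain ⟨φ, hφ, hφZ⟩ := HasExpansion.exists_of_mem_span (M := M) (Z := Z) (by
    rintro _ (rfl | ⟨⟨i, j⟩, rfl⟩)
    · exact ⟨g, (hs M).1, fun x hx => hx.1⟩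
    · refine ⟨_, ((HasExpansion.X M i).mul (hD j)).sub ((HasExpansion.X M j).mul (hD i)), ?_⟩
      rintro x ⟨-, t, ht⟩
      simp only [ht, PiLp.smul_apply, smul_eq_mul]
      ring) hN
  have hH := ((HasExpansion.sum Finset.univ fun i _ => (HasExpansion.X M i).pow 2).mul
    (HasExpansion.sum Finset.univ fun i _ => (HasExpansion.X M i).mul (hD i))).pow N
  obtain ⟨C, hC⟩ := (hH.isBigO_sub hφ).bound
  have hsmall : ∀ᶠ x : EuclideanSpace ℝ ι in 𝓝 0, C * ‖x‖ < 1 := by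
    have : Continuous fun x : EuclideanSpace ℝ ι => C * ‖x‖ := by fun_prop
    exact this.continuousAt.eventually_lt_const (by simp)
  filter_upwards [hC, hsmall] with x hCx hx1 hx0 hgx hpar
  by_contra! hle
  have hpos : 0 < ‖x‖ := norm_pos_iff.2 hx0
  obtain ⟨t, ht⟩ := hpar
  have hsum : ∑ i, x.ofLp i ^ 2 = ‖x‖ ^ 2 := (EuclideanSpace.real_norm_sq_eq x).symm
  have hsum' : ∑ i, x.ofLp i * (gradient g x).ofLp i = t * ‖x‖ ^ 2 := by
    rw [← hsum, Finset.mul_sum]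
    exact Finset.sum_congr rfl fun i _ => by simp only [ht, PiLp.smul_apply, smul_eq_mul]; ring
  rw [hφZ x ⟨hgx, t, ht⟩, sub_zero, hsum, hsum', norm_pow, norm_pow, norm_norm] at hCx
  have hnorm : ‖‖x‖ ^ 2 * (t * ‖x‖ ^ 2)‖ = ‖x‖ ^ 3 * ‖gradient g x‖ := by
    rw [ht, norm_smul, norm_mul, norm_mul, norm_pow, norm_norm]
    ring
  rw [hnorm] at hCx
  have h1 : ‖x‖ ^ ((m + 3) * N) ≤ (‖x‖ ^ 3 * ‖gradient g x‖) ^ N := by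
    rw [pow_mul, pow_add, mul_comm]
    gcongr
  have h2 : ‖x‖ ^ ((m + 3) * N) * 1 ≤ ‖x‖ ^ ((m + 3) * N) * (C * ‖x‖) := by
    rw [mul_one]
    refine (h1.trans hCx).trans_eq ?_
    simp only [M]
    ring
  exact absurd (le_of_mul_le_mul_left h2 (by positivity)) (not_le.2 hx1)

/-- **Szafraniec's Lemma (regular value on spheres).**
If `f` is real analytic near `0`, `f 0 = 0`, and `f` satisfies a Łojasiewicz gradient
inequality `‖∇f x‖ ≥ K * |f x| ^ ρ` near `0` with `0 < ρ < 1`, then for `c > 0` small and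
`k` a large enough integer, `0` is a regular value of the restriction of
`g x = f x - c * ‖x‖ ^ (2 * k)` to every sufficiently small sphere `S_r`: at every `x`
with `‖x‖ = r` and `g x = 0`, the gradient `∇g x` is not a scalar multiple of `x`. -/
theorem szafraniec_regular_value_on_spheres
    (n : ℕ) (f : EuclideanSpace ℝ (Fin n) → ℝ)
    (hf : AnalyticAt ℝ f 0) (hf0 : f 0 = 0)
    (K ρ : ℝ) (hK : 0 < K) (hρ0 : 0 < ρ) (hρ1 : ρ < 1)
    (hLoj : ∀ᶠ x in 𝓝 (0 : EuclideanSpace ℝ (Fin n)), K * |f x| ^ ρ ≤ ‖gradient f x‖) :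
    ∃ C > (0 : ℝ), ∃ α > (0 : ℝ), ∀ c : ℝ, 0 < c → c < C → ∀ k : ℕ, (α : ℝ) ≤ k →
      ∃ r₀ > (0 : ℝ), ∀ r : ℝ, 0 < r → r < r₀ →
        ∀ x : EuclideanSpace ℝ (Fin n), ‖x‖ = r →
          f x - c * ‖x‖ ^ (2 * k) = 0 →
          ∀ t : ℝ, gradient (fun y => f y - c * ‖y‖ ^ (2 * k)) x ≠ t • x := by
  have hρ : 0 < 1 - ρ := sub_pos.2 hρ1
  refine ⟨1, one_pos, 1 / (1 - ρ), by positivity, fun c hc _ k hk => ?_⟩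
  rw [div_le_iff₀ hρ] at hk
  obtain ⟨m, rfl⟩ : ∃ m, k = m + 1 := Nat.exists_eq_succ_of_ne_zero (by rintro rfl; norm_num at hk)
  have hnorm_deriv (x : EuclideanSpace ℝ (Fin n)) : HasFDerivAt
      (fun y : EuclideanSpace ℝ (Fin n) => c * ‖y‖ ^ (2 * (m + 1)))
      (c • ((m + 1) * ‖x‖ ^ (2 * m)) • (2 • innerSL ℝ x)) x := by
    simp only [pow_mul]
    refine (((hasStrictFDerivAt_norm_sq x).hasFDerivAt.pow (m + 1)).const_mul c).congr_fderiv ?_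
    simp
  have hnorm_an : AnalyticAt ℝ (fun y : EuclideanSpace ℝ (Fin n) => c * ‖y‖ ^ (2 * (m + 1))) 0 := by
    simp only [pow_mul]
    exact analyticAt_const.mul ((contDiff_norm_sq ℝ).contDiffAt.analyticAt.pow _)
  have hKc : 0 < K * c ^ ρ := by positivity
  have hsmall : ∀ᶠ x : EuclideanSpace ℝ (Fin n) in 𝓝 0,
      ‖x‖ < 1 ∧ ‖x‖ * (1 + 2 * c * (m + 1)) < K * c ^ ρ := by
    have h1 : Continuous fun x : EuclideanSpace ℝ (Fin n) => ‖x‖ := by fun_prop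
    have h2 : Continuous fun x : EuclideanSpace ℝ (Fin n) => ‖x‖ * (1 + 2 * c * (m + 1)) := by
      fun_prop
    exact (h1.continuousAt.eventually_lt_const (by simp)).and
      (h2.continuousAt.eventually_lt_const (by simpa using hKc))
  have hev := (hf.sub hnorm_an).eventually_norm_gradient_lt (2 * (m + 1))
  obtain ⟨r₀, hr₀, hball⟩ := Metric.eventually_nhds_iff.1
    (hLoj.and (hev.and (hsmall.and hf.eventually_analyticAt)))
  refine ⟨r₀, hr₀, ?_⟩
  rintro _ hr hr' x rfl hgx t ht
  obtain ⟨hLx, hgrad, ⟨hx1, hx2⟩, hfx⟩ := hball (y := x) (by simpa using hr')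
  have hlt := hgrad (norm_pos_iff.1 hr) hgx ⟨t, ht⟩
  have hfd := hfx.differentiableAt.hasFDerivAt.sub (hnorm_deriv x)
  have hf_norm : ‖gradient f x‖ = ‖fderiv ℝ f x‖ := by
    rw [← toDual_gradient, LinearIsometryEquiv.norm_map]
  rw [← (InnerProductSpace.toDual ℝ _).norm_map, toDual_gradient, hfd.fderiv] at hlt
  have hradial : ‖(c • ((m + 1) * ‖x‖ ^ (2 * m)) • (2 • innerSL ℝ x) :
      EuclideanSpace ℝ (Fin n) →L[ℝ] ℝ)‖ = 2 * c * (m + 1) * ‖x‖ ^ (2 * m) * ‖x‖ := by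
    rw [norm_smul, norm_smul, two_smul, ← two_smul ℝ, norm_smul, innerSL_apply_norm,
      Real.norm_of_nonneg hc.le, Real.norm_of_nonneg (by positivity), Real.norm_two]
    ring
  have hupper := norm_le_norm_sub_add (fderiv ℝ f x)
    (c • ((m + 1) * ‖x‖ ^ (2 * m)) • (2 • innerSL ℝ x))
  rw [hradial] at hupper
  have hlower : K * c ^ ρ * ‖x‖ ^ (2 * m) ≤ ‖fderiv ℝ f x‖ := by
    rw [← hf_norm]
    refine le_trans ?_ hLx
    rw [sub_eq_zero.1 hgx, abs_of_nonneg (by positivity), Real.mul_rpow hc.le (by positivity),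
      ← mul_assoc, ← Real.rpow_natCast_mul hr.le, ← Real.rpow_natCast]
    refine mul_le_mul_of_nonneg_left (Real.rpow_le_rpow_of_exponent_ge hr hx1.le ?_) hKc.le
    push_cast at hk ⊢
    linarith
  have hpow : ‖x‖ ^ (2 * (m + 1)) ≤ ‖x‖ ^ (2 * m) * ‖x‖ := by
    rw [← pow_succ]
    exact pow_le_pow_of_le_one hr.le hx1.le (by omega)
  have hmul := mul_lt_mul_of_pos_left hx2 (pow_pos hr (2 * m))
  linarith
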